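/- Fix positive integers k and d and a real number α > 2. Let G be a graph with tw(G) ≤ k − 1 and Δ(G) ≤ d. For any set S ⊆ V(G) with αk ≤ |S| ≤ 3αkd, there exists a tree-partition (B_x : x ∈ V(T)) of G with width at most (3α(α−1)/(α−2))·kd − (α/(α−2))·k, such that Δ(T) ≤ (3α/(α−2))·d + (α−4)/(α−2) and there exists a node z ∈ V(T) with: S ⊆ B_z, |B_z| ≤ ((α−1)/(α−2))·|S| − (α/(α−2))·k, and deg_T(z) ≤ (1/((α−2)k))·|S| − 2/(α−2). -/

import Mathlib

open SimpleGraph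

/-- The maximum degree of a finite simple graph `G`:
the supremum of the numbers of neighbours of its vertices. -/
noncomputable def maxDeg {V : Type*} [Fintype V] (G : SimpleGraph V) : ℕ :=
  sSup (Set.range fun v => (G.neighborSet v).ncard)

/-- `B` is a `T`-partition of the graph `G`: the tree `T` indexes a partition
`(B x : x ∈ V(T))` of `V(G)` such that for every edge `vw` of `G`, if `v ∈ B x` and
`w ∈ B y` then `x = y` or `xy ∈ E(T)`. -/
structure IsTreePartition {V ι : Type*} (G : SimpleGraph V) (T : SimpleGraph ι)
    (B : ι → Set V) : Prop where
  /-- `T` is a tree. -/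
  isTree : T.IsTree
  /-- the parts are nonempty -/
  part_nonempty : ∀ x, (B x).Nonempty
  /-- every vertex of `G` lies in exactly one part -/
  part_existsUnique : ∀ v, ∃! x, v ∈ B x
  /-- parts containing adjacent vertices are equal or adjacent in `T` -/
  part_adj : ∀ ⦃v w x y⦄, G.Adj v w → v ∈ B x → w ∈ B y → x = y ∨ T.Adj x y

/-- `B` is a tree-decomposition of the graph `G` over the tree `T`:
every edge of `G` has both ends in a common bag, and for each vertex `v` of `G`
the set of nodes whose bag contains `v` induces a non-empty subtree of `T`. -/
structure IsTreeDecomp {V ι : Type*} (G : SimpleGraph V) (T : SimpleGraph ι)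
    (B : ι → Set V) : Prop where
  /-- `T` is a tree. -/
  isTree : T.IsTree
  /-- every edge of `G` lies in some bag -/
  edge_mem : ∀ ⦃u v⦄, G.Adj u v → ∃ x, u ∈ B x ∧ v ∈ B x
  /-- the bags containing a given vertex induce a non-empty subtree -/
  subtree : ∀ v, (T.induce {x | v ∈ B x}).Connected

/-- The treewidth of a finite graph: the minimum, over tree-decompositions,
of the maximum bag size minus one. -/
noncomputable def treewidth {V : Type} [Fintype V] (G : SimpleGraph V) : ℕ :=
  sInf {k | ∃ (ι : Type) (_ : Fintype ι) (T : SimpleGraph ι) (B : ι → Set V),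
    IsTreeDecomp G T B ∧ ∀ x, (B x).ncard ≤ k + 1}

/-- The tree-partition-width of a finite graph: the minimum width of a tree-partition. -/
noncomputable def tpw {V : Type} [Fintype V] (G : SimpleGraph V) : ℕ :=
  sInf {k | ∃ (ι : Type) (_ : Fintype ι) (T : SimpleGraph ι) (B : ι → Set V),
    IsTreePartition G T B ∧ ∀ x, (B x).ncard ≤ k}

/-- In a tree, `s x t` may be chosen as the neighbour of `x` on the path from `x` to `t`. -/
lemma SimpleGraph.IsTree.exists_step {ι : Type*} {T : SimpleGraph ι} (hT : T.IsTree) :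
    ∃ s : ι → ι → ι, (∀ x t, t ≠ x → T.Adj x (s x t)) ∧
      (∀ x t t', T.Adj t t' → t ≠ x → t' ≠ x → s x t = s x t') ∧
      (∀ x t, t ≠ x → s (s x t) t ≠ x) := by
  choose p hp using fun x t => hT.connected.exists_isPath x t
  have hnil : ∀ x t, t ≠ x → ¬ (p x t).Nil := fun x t h hn => h hn.eq.symm
  refine ⟨fun x t => (p x t).snd, fun x t h => (p x t).adj_snd (hnil x t h), ?_, ?_⟩
  · have key : ∀ x t t', T.Adj t t' → t ≠ x → t ∈ (p x t').support →
        (p x t).snd = (p x t').snd := by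
      intro x t t' hadj ht hmem
      refine hT.isAcyclic.eq_snd_of_adj_start (hp x t') ((p x t).adj_snd (hnil x t ht)) ?_
      rw [hT.isAcyclic.path_concat (hp x t) (hp x t') hadj hmem]
      exact (p x t).support_subset_support_concat _ (List.mem_of_mem_tail
        ((p x t).snd_mem_tail_support (hnil x t ht)))
    intro x t t' hadj ht ht'
    by_cases hmem : t ∈ (p x t').support
    · exact key x t t' hadj ht hmem
    · exact (key x t' t hadj.symm ht' (hT.isAcyclic.mem_support_of_ne_mem_support_of_adj_of_isPath
        (hp x t) (hp x t') hadj hmem)).symm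
  · intro x t ht h
    have heq : p (p x t).snd t = (p x t).tail :=
      (hT.existsUnique_path _ _).unique (hp _ _) (hp x t).tail
    have hnd := (hp x t).support_nodup
    rw [← (p x t).cons_support_tail (hnil x t ht)] at hnd
    refine (List.nodup_cons.1 hnd).1 ?_
    rw [← heq]
    have hmem : (p (p x t).snd t).snd ∈ (p (p x t).snd t).support := Walk.getVert_mem_support _ _
    rwa [show (p (p x t).snd t).snd = x from h] at hmem

/-- For every node `x` of a tree-decomposition, the vertices outside the bag of `x` can be
labelled by neighbours of `x`, consistently along edges, and so that every label points
towards the bags containing the vertex. -/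
lemma IsTreeDecomp.exists_label {V ι : Type*} {G : SimpleGraph V} {T : SimpleGraph ι}
    {B : ι → Set V} (h : IsTreeDecomp G T B) :
    ∃ c : ι → V → ι, (∀ x v, v ∉ B x → T.Adj x (c x v)) ∧
      (∀ x v w, G.Adj v w → v ∉ B x → w ∉ B x → c x v = c x w) ∧
      (∀ x v, v ∉ B x → c (c x v) v ≠ x) := by
  obtain ⟨s, hs₁, hs₂, hs₃⟩ := h.isTree.exists_step
  have hmem : ∀ v, ∃ t, v ∈ B t := fun v => Set.nonempty_coe_sort.1 (h.subtree v).nonempty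
  choose t ht using hmem
  have hne : ∀ {x v u}, v ∉ B x → v ∈ B u → u ≠ x := by
    rintro x v u hx hu rfl
    exact hx hu
  have hconst : ∀ x v, v ∉ B x → ∀ u, v ∈ B u → s x (t v) = s x u := by
    intro x v hv u hu
    have hreach : ∀ a b : {y | v ∈ B y}, (T.induce {y | v ∈ B y}).Walk a b →
        s x a = s x b := by
      intro a b p
      induction p with
      | nil => rfl
      | @cons a b _ hadj _ ih => exact (hs₂ x a b hadj (hne hv a.2) (hne hv b.2)).trans ih
    obtain ⟨p⟩ := (h.subtree v).preconnected ⟨t v, ht v⟩ ⟨u, hu⟩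
    exact hreach _ _ p
  refine ⟨fun x v => s x (t v), fun x v hv => hs₁ x _ (hne hv (ht v)), ?_,
    fun x v hv => hs₃ x _ (hne hv (ht v))⟩
  intro x v w hadj hv hw
  obtain ⟨u, hvu, hwu⟩ := h.edge_mem hadj
  exact (hconst x v hv u hvu).trans (hconst x w hw u hwu).symm

/-- Moving every node of a finite tree along an incident edge, some node is moved back by the
second step. -/
lemma SimpleGraph.IsTree.exists_apply_apply_eq {ι : Type*} [Finite ι] {T : SimpleGraph ι}
    (hT : T.IsTree) (f : ι → ι) (hf : ∀ x, T.Adj x (f x)) : ∃ x, f (f x) = x := by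
  by_contra! hne
  have hinj : Function.Injective (fun x => (⟨s(x, f x), hf x⟩ : T.edgeSet)) := by
    intro x y hxy
    rcases Sym2.eq_iff.1 (congrArg Subtype.val hxy) with h | h
    · exact h.1
    · exact absurd (h.2 ▸ h.1.symm) (hne x)
  have hle := Nat.card_le_card_of_injective _ hinj
  have hcard := (isTree_iff_connected_and_card.1 hT).2
  exact absurd hle (by rw [← hcard]; exact Nat.not_succ_le_self _)

/-- Some bag of a finite tree-decomposition splits `S` in a balanced way. -/
lemma IsTreeDecomp.exists_balanced_label {V ι : Type*} [Finite V] [Finite ι] {G : SimpleGraph V}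
    {T : SimpleGraph ι} {B : ι → Set V} (h : IsTreeDecomp G T B) (S : Set V) :
    ∃ (x : ι) (c : V → ι), (∀ v w, G.Adj v w → v ∉ B x → w ∉ B x → c v = c w) ∧
      ∀ y, 2 * {v ∈ S | v ∉ B x ∧ c v = y}.ncard ≤ S.ncard := by
  obtain ⟨c, hc₁, hc₂, hc₃⟩ := h.exists_label
  by_contra! hcon
  choose f hf using fun x => hcon x (c x) (hc₂ x)
  have hadj : ∀ x, T.Adj x (f x) := by
    intro x
    obtain ⟨v, -, hv, hvx⟩ := Set.nonempty_of_ncard_ne_zero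
      (show {v ∈ S | v ∉ B x ∧ c x v = f x}.ncard ≠ 0 by have := hf x; omega)
    exact hvx ▸ hc₁ x v hv
  obtain ⟨x, hx⟩ := h.isTree.exists_apply_apply_eq f hadj
  have hdisj : Disjoint {v ∈ S | v ∉ B x ∧ c x v = f x}
      {v ∈ S | v ∉ B (f x) ∧ c (f x) v = f (f x)} := by
    rw [Set.disjoint_left]
    rintro v ⟨-, hv, hvx⟩ ⟨-, -, hvy⟩
    refine hc₃ x v hv ?_
    rw [hvx, hvy, hx]
  have hle := Set.ncard_le_ncard (Set.union_subset (Set.sep_subset S _) (Set.sep_subset S _) :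
    {v ∈ S | v ∉ B x ∧ c x v = f x} ∪ {v ∈ S | v ∉ B (f x) ∧ c (f x) v = f (f x)} ⊆ S)
  rw [Set.ncard_union_eq hdisj] at hle
  have := hf x
  have := hf (f x)
  omega

/-- Weights with total at most `s`, each at most `s / 2`, can be split into two groups of
total weight at most `2 s / 3`. -/
lemma exists_balanced_finset {ι : Type*} [Fintype ι] [DecidableEq ι] (w : ι → ℕ) (s : ℕ)
    (hsum : ∑ i, w i ≤ s) (hw : ∀ i, 2 * w i ≤ s) :
    ∃ P : Finset ι, 3 * ∑ i ∈ P, w i ≤ 2 * s ∧ 3 * ∑ i ∈ Pᶜ, w i ≤ 2 * s := by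
  by_cases hbig : ∃ i, s ≤ 3 * w i
  · obtain ⟨i, hi⟩ := hbig
    have := Finset.sum_add_sum_compl {i} w
    have := hw i
    refine ⟨{i}, ?_, ?_⟩ <;> rw [Finset.sum_singleton] at * <;> omega
  push Not at hbig
  obtain ⟨P, hP, hmax⟩ := Set.Finite.exists_maximal
    (Set.toFinite {P : Finset ι | 3 * ∑ i ∈ P, w i ≤ 2 * s}) ⟨∅, by simp⟩
  refine ⟨P, hP, ?_⟩
  by_contra! hlt
  obtain ⟨i, hi, -⟩ := Finset.exists_ne_zero_of_sum_ne_zero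
    (show ∑ i ∈ Pᶜ, w i ≠ 0 by omega)
  have hi' : i ∉ P := Finset.mem_compl.1 hi
  have hins : ¬ 3 * ∑ j ∈ insert i P, w j ≤ 2 * s := fun hle =>
    hi' (hmax (y := insert i P) hle (Finset.subset_insert i P) (Finset.mem_insert_self i P))
  rw [Finset.sum_insert hi'] at hins
  have := Finset.sum_add_sum_compl P w
  have := hbig i
  omega

/-- `G` has a balanced separation of order at most `k` for every set of vertices. -/
def HasBalancedSeparations {V : Type*} (G : SimpleGraph V) (k : ℕ) : Prop :=
  ∀ S : Set V, ∃ A₁ A₂ : Set V, A₁ ∪ A₂ = Set.univ ∧ (A₁ ∩ A₂).ncard ≤ k ∧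
    (∀ v w, G.Adj v w → (v ∈ A₁ ∧ w ∈ A₁) ∨ (v ∈ A₂ ∧ w ∈ A₂)) ∧
    3 * (S \ A₁).ncard ≤ 2 * S.ncard ∧ 3 * (S \ A₂).ncard ≤ 2 * S.ncard

lemma IsTreeDecomp.hasBalancedSeparations {V ι : Type*} [Finite V] [Fintype ι]
    {G : SimpleGraph V} {T : SimpleGraph ι} {B : ι → Set V} (h : IsTreeDecomp G T B) {k : ℕ}
    (hk : ∀ x, (B x).ncard ≤ k) : HasBalancedSeparations G k := by
  classical
  intro S
  obtain ⟨x, c, hc, hbal⟩ := h.exists_balanced_label S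
  let W : ι → Set V := fun y => {v ∈ S | v ∉ B x ∧ c v = y}
  have hdisj : ∀ P : Finset ι, (P : Set ι).PairwiseDisjoint W := by
    intro P y _ y' _ hne
    refine Set.disjoint_left.2 ?_
    rintro v ⟨-, -, hv⟩ ⟨-, -, hv'⟩
    exact hne (hv.symm.trans hv')
  have hcard : ∀ P : Finset ι, {v ∈ S | v ∉ B x ∧ c v ∈ P}.ncard = ∑ y ∈ P, (W y).ncard := by
    intro P
    have hW : {v ∈ S | v ∉ B x ∧ c v ∈ P} = ⋃ y ∈ P, W y := by
      ext v
      simp [W]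
    rw [hW, ← finsum_mem_coe_finset]
    exact P.finite_toSet.ncard_biUnion (fun y _ => Set.toFinite _) (hdisj P)
  obtain ⟨P, hP, hP'⟩ := exists_balanced_finset (fun y => (W y).ncard) S.ncard
    (by rw [← hcard]; exact Set.ncard_le_ncard (Set.sep_subset S _)) hbal
  rw [← hcard] at hP hP'
  refine ⟨{v | v ∈ B x ∨ c v ∈ P}, {v | v ∈ B x ∨ c v ∉ P}, ?_, ?_, ?_, ?_, ?_⟩
  · ext v
    simp only [Set.mem_union, Set.mem_ofPred_eq, Set.mem_univ, iff_true]
    tauto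
  · refine le_trans (Set.ncard_le_ncard ?_) (hk x)
    rintro v ⟨h₁ | h₁, h₂ | h₂⟩ <;> first | assumption | contradiction
  · intro v w hadj
    have := hc v w hadj
    grind
  · convert hP' using 3
    ext v
    simp only [Set.mem_sdiff, Set.mem_ofPred_eq, Finset.mem_compl]
    tauto
  · convert hP using 3
    ext v
    simp only [Set.mem_sdiff, Set.mem_ofPred_eq]
    tauto

lemma hasBalancedSeparations_of_treewidth_lt {V : Type} [Fintype V] {G : SimpleGraph V} {k : ℕ}
    (h : treewidth G < k) : HasBalancedSeparations G k := by
  have hne : {k | ∃ (ι : Type) (_ : Fintype ι) (T : SimpleGraph ι) (B : ι → Set V),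
      IsTreeDecomp G T B ∧ ∀ x, (B x).ncard ≤ k + 1}.Nonempty := by
    refine ⟨Fintype.card V, Unit, inferInstance, ⊥, fun _ => Set.univ,
      ⟨.of_subsingleton, fun _ _ _ => ⟨(), trivial, trivial⟩, fun v => ?_⟩, fun _ => ?_⟩
    · have : Nonempty {x : Unit | v ∈ (Set.univ : Set V)} := ⟨⟨(), trivial⟩⟩
      exact .of_subsingleton
    · rw [Set.ncard_univ, Nat.card_eq_fintype_card]
      omega
  obtain ⟨ι, _, T, B, hB, hw⟩ := Nat.sInf_mem hne
  exact hB.hasBalancedSeparations fun x => (hw x).trans h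

lemma ncard_neighborSet_le_maxDeg {V : Type*} [Fintype V] (G : SimpleGraph V) (v : V) :
    (G.neighborSet v).ncard ≤ maxDeg G :=
  le_csSup (Set.finite_range _).bddAbove ⟨v, rfl⟩

/-- The graph on `Option ι` joining every `some i` to its parent `p i`. -/
def parentGraph {ι : Type*} (p : ι → Option ι) : SimpleGraph (Option ι) :=
  SimpleGraph.fromRel fun x y => ∃ i, x = some i ∧ y = p i

/-- `p` is the parent function of a tree on `Option ι` with root `none`, and the sets `B x` are
the parts of a partition of the subgraph of `G` induced on `U` along this tree. -/
structure IsRootedTreePartition {V ι : Type*} (G : SimpleGraph V) (U : Set V)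
    (p : ι → Option ι) (B : Option ι → Set V) : Prop where
  /-- parents have smaller height than their children -/
  exists_height : ∃ h : ι → ℕ, ∀ i j, p i = some j → h j < h i
  part_nonempty : ∀ x, (B x).Nonempty
  part_subset : ∀ x, B x ⊆ U
  part_exists : ∀ v ∈ U, ∃ x, v ∈ B x
  part_unique : ∀ v x y, v ∈ B x → v ∈ B y → x = y
  part_adj : ∀ v w x y, G.Adj v w → v ∈ B x → w ∈ B y → x = y ∨ (parentGraph p).Adj x y

lemma parentGraph_adj {ι : Type*} {p : ι → Option ι} {x y : Option ι} :
    (parentGraph p).Adj x y ↔ x ≠ y ∧ ((∃ i, x = some i ∧ y = p i) ∨ ∃ i, y = some i ∧ x = p i) :=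
  Iff.rfl

lemma adj_parentGraph_of_eq {ι : Type*} {p : ι → Option ι} {h : ι → ℕ}
    (hh : ∀ i j, p i = some j → h j < h i) {i : ι} {x : Option ι} (hx : p i = x) :
    (parentGraph p).Adj (some i) x := by
  refine parentGraph_adj.2 ⟨?_, .inl ⟨i, rfl, hx.symm⟩⟩
  rintro rfl
  exact (hh i i hx).false

lemma isTree_parentGraph {ι : Type*} [Finite ι] {p : ι → Option ι} {h : ι → ℕ}
    (hh : ∀ i j, p i = some j → h j < h i) : (parentGraph p).IsTree := by
  have hroot : ∀ n i, h i < n → (parentGraph p).Reachable (some i) none := by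
    intro n
    induction n with
    | zero => exact fun i hi => absurd hi (Nat.not_lt_zero _)
    | succ n ih =>
      intro i hi
      have hadj := (adj_parentGraph_of_eq hh (rfl : p i = p i)).reachable
      cases hp : p i with
      | none => rwa [hp] at hadj
      | some j =>
        rw [hp] at hadj
        exact hadj.trans (ih j (by have := hh i j hp; omega))
  have hroot' : ∀ x, (parentGraph p).Reachable x none := by
    rintro (_ | i)
    · exact .rfl
    · exact hroot _ i (Nat.lt_succ_self _)
  have hconn : (parentGraph p).Connected :=
    (connected_iff _).2 ⟨fun x y => (hroot' x).trans (hroot' y).symm, ⟨none⟩⟩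
  refine isTree_iff_connected_and_card.2 ⟨hconn, le_antisymm ?_
    hconn.card_vert_le_card_edgeSet_add_one⟩
  rw [Finite.card_option]
  refine Nat.add_le_add_right (Nat.card_le_card_of_surjective
    (fun i => (⟨s(some i, p i), adj_parentGraph_of_eq hh rfl⟩ : (parentGraph p).edgeSet)) ?_) 1
  rintro ⟨e, he⟩
  induction e with
  | _ x y =>
    rcases (parentGraph_adj.1 he).2 with ⟨i, rfl, rfl⟩ | ⟨i, rfl, rfl⟩
    · exact ⟨i, rfl⟩
    · exact ⟨i, Subtype.ext Sym2.eq_swap⟩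

lemma ncard_neighborSet_parentGraph_none_le {ι : Type*} [Finite ι] (p : ι → Option ι) :
    ((parentGraph p).neighborSet none).ncard ≤ {i | p i = none}.ncard := by
  refine le_trans (Set.ncard_le_ncard ?_) (Set.ncard_image_le (f := some))
  rintro x hx
  rcases (parentGraph_adj.1 hx).2 with ⟨i, h, -⟩ | ⟨i, rfl, h⟩
  · cases h
  · exact ⟨i, h.symm, rfl⟩

lemma ncard_neighborSet_parentGraph_some_le {ι : Type*} [Finite ι] (p : ι → Option ι) (j : ι) :
    ((parentGraph p).neighborSet (some j)).ncard ≤ {i | p i = some j}.ncard + 1 := by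
  refine le_trans (Set.ncard_le_ncard (t := insert (p j) (some '' {i | p i = some j})) ?_)
    ((Set.ncard_insert_le _ _).trans (Nat.add_le_add_right Set.ncard_image_le 1))
  rintro x hx
  rcases (parentGraph_adj.1 hx).2 with ⟨i, h, rfl⟩ | ⟨i, rfl, h⟩
  · cases h
    exact .inl rfl
  · exact .inr ⟨i, h.symm, rfl⟩

namespace IsRootedTreePartition

variable {V ι ι₁ ι₂ : Type*} {G : SimpleGraph V} {U U₁ U₂ : Set V}

lemma isTreePartition [Finite ι] {p : ι → Option ι} {B : Option ι → Set V}
    (H : IsRootedTreePartition G Set.univ p B) : IsTreePartition G (parentGraph p) B where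
  isTree := H.exists_height.elim fun _ hh => isTree_parentGraph hh
  part_nonempty := H.part_nonempty
  part_existsUnique v := (H.part_exists v trivial).elim fun x hx =>
    ⟨x, hx, fun _ hy => H.part_unique v _ _ hy hx⟩
  part_adj := H.part_adj

/-- The rooted tree-partition with a single part. -/
lemma single (hU : U.Nonempty) :
    IsRootedTreePartition G U (Empty.elim : Empty → Option Empty) fun _ => U where
  exists_height := ⟨Empty.elim, fun i => i.elim⟩
  part_nonempty _ := hU
  part_subset _ := subset_rfl
  part_exists _ hv := ⟨none, hv⟩
  part_unique _ _ _ _ _ := Subsingleton.elim _ _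
  part_adj _ _ _ _ _ _ _ := .inl (Subsingleton.elim _ _)

/-- Adding a new root part `S` whose neighbours all lie in the old root part. -/
lemma extend {p : ι → Option ι} {B : Option ι → Set V} (H : IsRootedTreePartition G U p B)
    {S : Set V} (hS : S.Nonempty) (hdisj : Disjoint S U)
    (hadj : ∀ v ∈ S, ∀ w ∈ U, G.Adj v w → w ∈ B none) :
    IsRootedTreePartition G (S ∪ U) (fun x : Option ι => x.map p) (fun x => x.elim S B) where
  exists_height := by
    obtain ⟨h, hh⟩ := H.exists_height
    refine ⟨fun x => x.elim 0 fun i => h i + 1, ?_⟩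
    rintro (_ | i) (_ | j) hij
    · cases hij
    · cases hij
    · exact Nat.succ_pos _
    · exact Nat.succ_lt_succ (hh i j (Option.some_injective _ hij))
  part_nonempty := by
    rintro (_ | x)
    · exact hS
    · exact H.part_nonempty x
  part_subset := by
    rintro (_ | x)
    · exact Set.subset_union_left
    · exact (H.part_subset x).trans Set.subset_union_right
  part_exists := by
    rintro v (hv | hv)
    · exact ⟨none, hv⟩
    · obtain ⟨x, hx⟩ := H.part_exists v hv
      exact ⟨some x, hx⟩
  part_unique := by
    rintro v (_ | x) (_ | y) hx hy
    · rfl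
    · exact absurd (H.part_subset y hy) (hdisj.notMem_of_mem_left hx)
    · exact absurd (H.part_subset x hx) (hdisj.notMem_of_mem_left hy)
    · exact congrArg some (H.part_unique v x y hx hy)
  part_adj := by
    rintro v w (_ | x) (_ | y) hvw hx hy
    · exact .inl rfl
    · have := H.part_unique w _ _ hy (hadj v hx w (H.part_subset y hy) hvw)
      subst this
      exact .inr (parentGraph_adj.2 ⟨by simp, .inr ⟨none, rfl, rfl⟩⟩)
    · have := H.part_unique v _ _ hx (hadj w hy v (H.part_subset x hx) hvw.symm)
      subst this
      exact .inr (parentGraph_adj.2 ⟨by simp, .inl ⟨none, rfl, rfl⟩⟩)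
    · rcases H.part_adj v w x y hvw hx hy with rfl | h
      · exact .inl rfl
      · obtain ⟨hne, ⟨i, rfl, rfl⟩ | ⟨i, rfl, rfl⟩⟩ := parentGraph_adj.1 h
        · exact .inr (parentGraph_adj.2 ⟨by simpa using hne, .inl ⟨some i, rfl, rfl⟩⟩)
        · exact .inr (parentGraph_adj.2 ⟨by simpa using hne, .inr ⟨some i, rfl, rfl⟩⟩)

/-- The parent function of the tree obtained from two rooted trees by identifying the roots. -/
def mergeParent (p₁ : ι₁ → Option ι₁) (p₂ : ι₂ → Option ι₂) : ι₁ ⊕ ι₂ → Option (ι₁ ⊕ ι₂) :=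
  Sum.elim (fun i => (p₁ i).map Sum.inl) fun i => (p₂ i).map Sum.inr

/-- The parts of the tree-partition obtained from two rooted ones by merging the root parts. -/
def mergePart (B₁ : Option ι₁ → Set V) (B₂ : Option ι₂ → Set V) : Option (ι₁ ⊕ ι₂) → Set V :=
  fun x => x.elim (B₁ none ∪ B₂ none) (Sum.elim (fun i => B₁ (some i)) fun i => B₂ (some i))

lemma mergePart_cases {B₁ : Option ι₁ → Set V} {B₂ : Option ι₂ → Set V}
    {x : Option (ι₁ ⊕ ι₂)} {v : V} (hv : v ∈ mergePart B₁ B₂ x) :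
    (∃ y, x = y.map Sum.inl ∧ v ∈ B₁ y) ∨ ∃ y, x = y.map Sum.inr ∧ v ∈ B₂ y := by
  rcases x with _ | i | i
  · rcases hv with hv | hv
    · exact .inl ⟨none, rfl, hv⟩
    · exact .inr ⟨none, rfl, hv⟩
  · exact .inl ⟨some i, rfl, hv⟩
  · exact .inr ⟨some i, rfl, hv⟩

/-- Two rooted tree-partitions meeting only in the root parts can be merged at the root. -/
lemma merge {p₁ : ι₁ → Option ι₁} {B₁ : Option ι₁ → Set V}
    {p₂ : ι₂ → Option ι₂} {B₂ : Option ι₂ → Set V}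
    (H₁ : IsRootedTreePartition G U₁ p₁ B₁) (H₂ : IsRootedTreePartition G U₂ p₂ B₂)
    (h₁ : U₁ ∩ U₂ ⊆ B₁ none) (h₂ : U₁ ∩ U₂ ⊆ B₂ none)
    (hadj : ∀ v ∈ U₁ ∪ U₂, ∀ w ∈ U₁ ∪ U₂, G.Adj v w → (v ∈ U₁ ∧ w ∈ U₁) ∨ (v ∈ U₂ ∧ w ∈ U₂)) :
    IsRootedTreePartition G (U₁ ∪ U₂) (mergeParent p₁ p₂) (mergePart B₁ B₂) := by
  have hl : ∀ y, B₁ y ⊆ mergePart B₁ B₂ (y.map Sum.inl) := by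
    rintro (_ | y)
    · exact Set.subset_union_left
    · exact subset_rfl
  have hr : ∀ y, B₂ y ⊆ mergePart B₁ B₂ (y.map Sum.inr) := by
    rintro (_ | y)
    · exact Set.subset_union_right
    · exact subset_rfl
  have hsub : ∀ x, mergePart B₁ B₂ x ⊆ U₁ ∪ U₂ := by
    intro x v hv
    rcases mergePart_cases hv with ⟨y, -, hy⟩ | ⟨y, -, hy⟩
    · exact .inl (H₁.part_subset y hy)
    · exact .inr (H₂.part_subset y hy)
  have hunique : ∀ v x y, v ∈ mergePart B₁ B₂ x → v ∈ mergePart B₁ B₂ y → x = y := by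
    intro v x y hx hy
    rcases mergePart_cases hx with ⟨x', rfl, hx'⟩ | ⟨x', rfl, hx'⟩ <;>
    rcases mergePart_cases hy with ⟨y', rfl, hy'⟩ | ⟨y', rfl, hy'⟩
    · rw [H₁.part_unique v _ _ hx' hy']
    · have hv : v ∈ U₁ ∩ U₂ := ⟨H₁.part_subset _ hx', H₂.part_subset _ hy'⟩
      rw [H₁.part_unique v _ _ hx' (h₁ hv), H₂.part_unique v _ _ hy' (h₂ hv)]
      rfl
    · have hv : v ∈ U₁ ∩ U₂ := ⟨H₁.part_subset _ hy', H₂.part_subset _ hx'⟩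
      rw [H₂.part_unique v _ _ hx' (h₂ hv), H₁.part_unique v _ _ hy' (h₁ hv)]
      rfl
    · rw [H₂.part_unique v _ _ hx' hy']
  refine ⟨?_, ?_, hsub, ?_, hunique, ?_⟩
  · obtain ⟨f₁, hf₁⟩ := H₁.exists_height
    obtain ⟨f₂, hf₂⟩ := H₂.exists_height
    refine ⟨Sum.elim f₁ f₂, ?_⟩
    rintro (i | i) (j | j) hij <;> obtain ⟨k, hk, hkj⟩ := Option.map_eq_some_iff.1 hij <;> cases hkj
    · exact hf₁ i j hk
    · exact hf₂ i j hk
  · rintro (_ | i | i)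
    · exact (H₁.part_nonempty none).mono Set.subset_union_left
    · exact H₁.part_nonempty _
    · exact H₂.part_nonempty _
  · rintro v (hv | hv)
    · obtain ⟨y, hy⟩ := H₁.part_exists v hv
      exact ⟨_, hl y hy⟩
    · obtain ⟨y, hy⟩ := H₂.part_exists v hv
      exact ⟨_, hr y hy⟩
  · intro v w x y hvw hx hy
    rcases hadj v (hsub x hx) w (hsub y hy) hvw with ⟨hv, hw⟩ | ⟨hv, hw⟩
    · obtain ⟨x', hx'⟩ := H₁.part_exists v hv
      obtain ⟨y', hy'⟩ := H₁.part_exists w hw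
      rw [hunique v x _ hx (hl _ hx'), hunique w y _ hy (hl _ hy')]
      rcases H₁.part_adj v w x' y' hvw hx' hy' with rfl | h
      · exact .inl rfl
      · obtain ⟨hne, h⟩ := parentGraph_adj.1 h
        refine .inr (parentGraph_adj.2 ⟨(Option.map_injective Sum.inl_injective).ne hne, ?_⟩)
        rcases h with ⟨i, rfl, rfl⟩ | ⟨i, rfl, rfl⟩
        · exact .inl ⟨.inl i, rfl, rfl⟩
        · exact .inr ⟨.inl i, rfl, rfl⟩
    · obtain ⟨x', hx'⟩ := H₂.part_exists v hv
      obtain ⟨y', hy'⟩ := H₂.part_exists w hw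
      rw [hunique v x _ hx (hr _ hx'), hunique w y _ hy (hr _ hy')]
      rcases H₂.part_adj v w x' y' hvw hx' hy' with rfl | h
      · exact .inl rfl
      · obtain ⟨hne, h⟩ := parentGraph_adj.1 h
        refine .inr (parentGraph_adj.2 ⟨(Option.map_injective Sum.inr_injective).ne hne, ?_⟩)
        rcases h with ⟨i, rfl, rfl⟩ | ⟨i, rfl, rfl⟩
        · exact .inl ⟨.inr i, rfl, rfl⟩
        · exact .inr ⟨.inr i, rfl, rfl⟩

end IsRootedTreePartition

/-- The subgraph of `G` induced on `U` has a rooted tree-partition whose root part contains `S`.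
The non-root parts have size at most `W` and the non-root nodes have degree at most `D`, while
the size of the root part and the degree of the root are linearly bounded in `|S|`. -/
def HasMarkedPartition {V : Type*} (G : SimpleGraph V) (k : ℕ) (a W D : ℝ) (U S : Set V) : Prop :=
  ∃ (ι : Type) (_ : Finite ι) (p : ι → Option ι) (B : Option ι → Set V),
    IsRootedTreePartition G U p B ∧ (∀ i, ((B (some i)).ncard : ℝ) ≤ W) ∧
    (∀ i, ({j | p j = some i}.ncard : ℝ) + 1 ≤ D) ∧ S ⊆ B none ∧
    ((B none).ncard : ℝ) ≤ (1 + a) * S.ncard - (1 + 2 * a) * k ∧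
    k * ({j | p j = none}.ncard : ℝ) ≤ a * S.ncard - 2 * a * k

namespace HasMarkedPartition

variable {V : Type*} {G : SimpleGraph V} {k : ℕ} {a W D : ℝ} {U S : Set V}

lemma single (hS : S.Nonempty) (hk : (1 + 2 * a) * k ≤ a * S.ncard) :
    HasMarkedPartition G k a W D S S := by
  refine ⟨Empty, inferInstance, _, _, .single hS, fun i => i.elim, fun i => i.elim, subset_rfl,
    ?_, ?_⟩
  · linarith
  · rw [Set.eq_empty_of_isEmpty {j : Empty | _}, Set.ncard_empty]
    have : (0 : ℝ) ≤ k := k.cast_nonneg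
    push_cast
    linarith

lemma extend {ι : Type} [Finite ι] {p : ι → Option ι} {B : Option ι → Set V}
    (hS : S.Nonempty) (hSU : S ⊆ U) (hk : (1 + 2 * a) * k ≤ a * S.ncard)
    (H : IsRootedTreePartition G (U \ S) p B)
    (hadj : ∀ v ∈ S, ∀ w ∈ U \ S, G.Adj v w → w ∈ B none)
    (hB : ∀ x, ((B x).ncard : ℝ) ≤ W) (hD : ∀ x, ({j | p j = x}.ncard : ℝ) + 1 ≤ D) :
    HasMarkedPartition G k a W D U S := by
  have H' := H.extend hS Set.disjoint_sdiff_right hadj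
  rw [Set.union_sdiff_cancel hSU] at H'
  refine ⟨Option ι, inferInstance, _, _, H', hB, fun x => le_trans ?_ (hD x), subset_rfl, ?_, ?_⟩
  · have hle : {j : Option ι | j.map p = some x}.ncard ≤ {j | p j = x}.ncard := by
      refine le_trans (Set.ncard_le_ncard ?_) (Set.ncard_image_le (f := some))
      rintro j hj
      obtain ⟨i, rfl, hi⟩ := Option.map_eq_some_iff.1 hj
      exact ⟨i, hi, rfl⟩
    exact_mod_cast Nat.add_le_add_right hle 1
  · change (S.ncard : ℝ) ≤ _
    linarith
  · have heq : {j : Option ι | j.map p = none} = {none} := by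
      ext j
      simp
    rw [heq, Set.ncard_singleton]
    push_cast
    linarith

open IsRootedTreePartition in
lemma merge [Finite V] (ha : 0 ≤ a) {U₁ U₂ S₁ S₂ : Set V}
    (h₁ : HasMarkedPartition G k a W D U₁ S₁) (h₂ : HasMarkedPartition G k a W D U₂ S₂)
    (hX₁ : U₁ ∩ U₂ ⊆ S₁) (hX₂ : U₁ ∩ U₂ ⊆ S₂) (hX : (U₁ ∩ U₂).ncard ≤ k)
    (hadj : ∀ v ∈ U₁ ∪ U₂, ∀ w ∈ U₁ ∪ U₂, G.Adj v w → (v ∈ U₁ ∧ w ∈ U₁) ∨ (v ∈ U₂ ∧ w ∈ U₂))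
    (hS : S ⊆ S₁ ∪ S₂) (hcard : S₁.ncard + S₂.ncard ≤ S.ncard + 2 * (U₁ ∩ U₂).ncard) :
    HasMarkedPartition G k a W D (U₁ ∪ U₂) S := by
  obtain ⟨ι₁, _, p₁, B₁, H₁, hW₁, hD₁, hS₁, hB₁, hc₁⟩ := h₁
  obtain ⟨ι₂, _, p₂, B₂, H₂, hW₂, hD₂, hS₂, hB₂, hc₂⟩ := h₂
  have hcardR : (S₁.ncard : ℝ) + S₂.ncard ≤ S.ncard + 2 * (U₁ ∩ U₂).ncard := by
    exact_mod_cast hcard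
  have hXR : ((U₁ ∩ U₂).ncard : ℝ) ≤ k := by exact_mod_cast hX
  refine ⟨ι₁ ⊕ ι₂, inferInstance, _, _,
    H₁.merge H₂ (hX₁.trans hS₁) (hX₂.trans hS₂) hadj, ?_, ?_,
    hS.trans (Set.union_subset_union hS₁ hS₂), ?_, ?_⟩
  · rintro (i | i)
    · exact hW₁ i
    · exact hW₂ i
  · rintro (i | i)
    · refine le_trans ?_ (hD₁ i)
      have hle : {j | mergeParent p₁ p₂ j = some (.inl i)}.ncard ≤ {j | p₁ j = some i}.ncard := by
        refine le_trans (Set.ncard_le_ncard ?_) (Set.ncard_image_le (f := Sum.inl))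
        rintro (j | j) hj <;> obtain ⟨l, hl, hli⟩ := Option.map_eq_some_iff.1 hj <;> cases hli
        exact ⟨j, hl, rfl⟩
      exact_mod_cast Nat.add_le_add_right hle 1
    · refine le_trans ?_ (hD₂ i)
      have hle : {j | mergeParent p₁ p₂ j = some (.inr i)}.ncard ≤ {j | p₂ j = some i}.ncard := by
        refine le_trans (Set.ncard_le_ncard ?_) (Set.ncard_image_le (f := Sum.inr))
        rintro (j | j) hj <;> obtain ⟨l, hl, hli⟩ := Option.map_eq_some_iff.1 hj <;> cases hli
        exact ⟨j, hl, rfl⟩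
      exact_mod_cast Nat.add_le_add_right hle 1
  · have hle : (B₁ none ∪ B₂ none).ncard + (U₁ ∩ U₂).ncard ≤ (B₁ none).ncard + (B₂ none).ncard := by
      rw [← Set.ncard_union_add_ncard_inter (B₁ none)]
      exact Nat.add_le_add_left
        (Set.ncard_le_ncard (Set.subset_inter (hX₁.trans hS₁) (hX₂.trans hS₂))) _
    have hleR : ((B₁ none ∪ B₂ none).ncard : ℝ) + (U₁ ∩ U₂).ncard ≤
        (B₁ none).ncard + (B₂ none).ncard := by exact_mod_cast hle
    change ((B₁ none ∪ B₂ none).ncard : ℝ) ≤ _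
    nlinarith
  · have hle : {j | mergeParent p₁ p₂ j = none}.ncard ≤
        {j | p₁ j = none}.ncard + {j | p₂ j = none}.ncard := by
      refine le_trans (Set.ncard_le_ncard
        (t := Sum.inl '' {j | p₁ j = none} ∪ Sum.inr '' {j | p₂ j = none}) ?_)
        ((Set.ncard_union_le _ _).trans (Nat.add_le_add Set.ncard_image_le Set.ncard_image_le))
      rintro (j | j) hj
      · exact .inl ⟨j, Option.map_eq_none_iff.1 hj, rfl⟩
      · exact .inr ⟨j, Option.map_eq_none_iff.1 hj, rfl⟩
    have hleR : ({j | mergeParent p₁ p₂ j = none}.ncard : ℝ) ≤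
        {j | p₁ j = none}.ncard + {j | p₂ j = none}.ncard := by exact_mod_cast hle
    have := mul_le_mul_of_nonneg_left hleR (k.cast_nonneg (α := ℝ))
    nlinarith

end HasMarkedPartition

/-- The neighbourhood of a set `S` in a graph of maximum degree `d` has at most `d |S|` vertices. -/
lemma ncard_biUnion_neighborSet_le {V : Type*} [Finite V] {G : SimpleGraph V} {d : ℕ}
    (hdeg : ∀ v, (G.neighborSet v).ncard ≤ d) (S : Set V) :
    (⋃ v ∈ S, G.neighborSet v).ncard ≤ S.ncard * d := by
  have := Fintype.ofFinite V
  classical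
  have hle := (S.toFinset.set_ncard_biUnion_le G.neighborSet).trans
    (Finset.sum_le_card_nsmul _ _ d fun v _ => hdeg v)
  simpa [Set.ncard_eq_toFinset_card'] using hle

/-- The induction behind the main theorem, in terms of `a = 1 / (α - 2)`. -/
lemma hasMarkedPartition_of_hasBalancedSeparations {V : Type*} [Finite V] {G : SimpleGraph V}
    {k d : ℕ} (hk : 1 ≤ k) (hd : 1 ≤ d) (hsep : HasBalancedSeparations G k)
    (hdeg : ∀ v, (G.neighborSet v).ncard ≤ d) {α a W D : ℝ} (ha : 0 < a)
    (haα : a * α = 1 + 2 * a) (hW : W = (3 * α + 3 + 6 * a) * (k * d) - (1 + 2 * a) * k)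
    (hD : D = (3 + 6 * a) * d + 1 - 2 * a) (U S : Set V) (hSU : S ⊆ U)
    (hS₁ : α * k ≤ S.ncard) (hS₂ : (S.ncard : ℝ) ≤ 3 * α * (k * d)) :
    HasMarkedPartition G k a W D U S := by
  have hα : 2 < α := by nlinarith
  have hkR : (1 : ℝ) ≤ k := by exact_mod_cast hk
  have hdR : (1 : ℝ) ≤ d := by exact_mod_cast hd
  have hkd : (k : ℝ) ≤ k * d := le_mul_of_one_le_right (by linarith) hdR
  have hαk : 2 < α * k := by nlinarith
  have hαkd : α * k ≤ α * (k * d) := mul_le_mul_of_nonneg_left hkd (by linarith)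
  have hWk : 3 * α * k ≤ W := by
    have := mul_le_mul_of_nonneg_left hkd (show 0 ≤ 3 * α + 3 + 6 * a by linarith)
    nlinarith
  have hD₁ : 1 ≤ D := by nlinarith
  induction hn : U.ncard using Nat.strong_induction_on generalizing U S with
  | _ n ih =>
  subst hn
  have hSpos : 0 < S.ncard := by exact_mod_cast (by linarith : (0 : ℝ) < S.ncard)
  have hSne : S.Nonempty := Set.nonempty_of_ncard_ne_zero hSpos.ne'
  have hSa : (1 + 2 * a) * k ≤ a * S.ncard := by
    have := mul_le_mul_of_nonneg_left hS₁ ha.le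
    rwa [← mul_assoc, haα] at this
  have hUS : (U \ S).ncard + S.ncard = U.ncard := Set.ncard_sdiff_add_ncard_of_subset hSU
  by_cases hsmall : ((U \ S).ncard : ℝ) ≤ W
  · rcases (U \ S).eq_empty_or_nonempty with hemp | hne
    · rw [(Set.sdiff_eq_empty.1 hemp).antisymm hSU]
      exact .single hSne hSa
    · exact .extend hSne hSU hSa (.single hne) (fun v _ w hw _ => hw) (fun _ => hsmall)
        fun x => by simpa [Set.eq_empty_of_isEmpty] using hD₁
  push Not at hsmall
  by_cases hS₃ : (S.ncard : ℝ) ≤ 3 * α * k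
  · set N : Set V := (⋃ v ∈ S, G.neighborSet v) ∩ (U \ S)
    have hNd : (N.ncard : ℝ) ≤ S.ncard * d := by
      exact_mod_cast (Set.ncard_le_ncard Set.inter_subset_left).trans
        (ncard_biUnion_neighborSet_le hdeg S)
    have hceil := Nat.ceil_lt_add_one (show 0 ≤ α * k by linarith)
    obtain ⟨S', hNS', hS'U, hS'⟩ := Set.exists_subsuperset_card_eq
      (show N ⊆ U \ S from Set.inter_subset_right) (le_max_left _ ⌈α * k⌉₊)
      (max_le (Set.ncard_le_ncard Set.inter_subset_right)
        (by exact_mod_cast (by linarith : (⌈α * k⌉₊ : ℝ) ≤ (U \ S).ncard)))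
    have hS'₁ : α * k ≤ S'.ncard := by
      rw [hS']
      exact (Nat.le_ceil _).trans (by exact_mod_cast le_max_right _ _)
    have hS'₂ : (S'.ncard : ℝ) ≤ 3 * α * (k * d) := by
      rw [hS', Nat.cast_max]
      refine max_le (hNd.trans ?_) (by linarith)
      have := mul_le_mul_of_nonneg_right hS₃ (show (0 : ℝ) ≤ d by linarith)
      linarith
    obtain ⟨ι, _, p, B, H, hBW, hpD, hroot, hBroot, hproot⟩ :=
      ih _ (by omega) (U \ S) S' hS'U hS'₁ hS'₂ rfl
    refine .extend hSne hSU hSa H ?_ ?_ ?_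
    · intro v hv w hw hvw
      exact hroot (hNS' ⟨Set.mem_biUnion hv hvw, hw⟩)
    · rintro (_ | i)
      · refine hBroot.trans ?_
        have := mul_le_mul_of_nonneg_left hS'₂ (show 0 ≤ 1 + a by linarith)
        have : (a * α) * (k * d) = (1 + 2 * a) * (k * d) := by rw [haα]
        rw [hW]
        linarith
      · exact hBW i
    · rintro (_ | i)
      · have h₁ := mul_le_mul_of_nonneg_left hS'₂ ha.le
        have h₂ : (a * α) * (k * d) = (1 + 2 * a) * (k * d) := by rw [haα]
        have h₃ : (k : ℝ) * ({j | p j = none}.ncard + 1) ≤ k * D := by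
          rw [hD]
          linarith
        exact le_of_mul_le_mul_left h₃ (by linarith)
      · exact hpD i
  push Not at hS₃
  obtain ⟨A₁, A₂, hA, hAk, hAadj, hSA₁, hSA₂⟩ := hsep S
  set X : Set V := U ∩ A₁ ∩ (U ∩ A₂) with hX
  have hXk : X.ncard ≤ k := (Set.ncard_le_ncard
    (Set.inter_subset_inter Set.inter_subset_right Set.inter_subset_right)).trans hAk
  have hU : U ∩ A₁ ∪ U ∩ A₂ = U := by rw [← Set.inter_union_distrib_left, hA, Set.inter_univ]
  have hSk : 3 * k < S.ncard := by
    exact_mod_cast (by nlinarith : (3 : ℝ) * k < S.ncard)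
  have key : ∀ A A' : Set V, A ∪ A' = Set.univ → U ∩ A ∩ (U ∩ A') = X →
      3 * (S \ A).ncard ≤ 2 * S.ncard → 3 * (S \ A').ncard ≤ 2 * S.ncard →
      HasMarkedPartition G k a W D (U ∩ A) (S \ A' ∪ X) := by
    intro A A' hAA' hAX hSA hSA'
    have hle := Set.ncard_union_le (S \ A') X
    have hcov : S ⊆ (S \ A) ∪ (S \ A' ∪ X) := by
      intro v hv
      by_cases h : v ∈ A
      · by_cases h' : v ∈ A'
        · exact .inr (.inr (hAX ▸ ⟨⟨hSU hv, h⟩, hSU hv, h'⟩))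
        · exact .inr (.inl ⟨hv, h'⟩)
      · exact .inl ⟨hv, h⟩
    have hcov' := (Set.ncard_le_ncard hcov).trans (Set.ncard_union_le _ _)
    have hlt : (U ∩ A).ncard < U.ncard := by
      refine Set.ncard_lt_ncard (Set.inter_subset_left.ssubset_of_ne fun h => ?_)
      have hSA₀ : S \ A = ∅ := Set.sdiff_eq_empty.2 (hSU.trans (Set.inter_eq_left.1 h))
      rw [hSA₀, Set.ncard_empty] at hcov'
      omega
    refine ih _ hlt (U ∩ A) _ ?_ ?_ ?_ rfl
    · refine Set.union_subset (fun v hv => ⟨hSU hv.1, ?_⟩) (hAX ▸ Set.inter_subset_left)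
      exact (hAA' ▸ Set.mem_univ v : v ∈ A ∪ A').resolve_right hv.2
    · have hge : (S.ncard : ℝ) ≤ 3 * (S \ A' ∪ X).ncard := by
        exact_mod_cast (by omega : S.ncard ≤ 3 * (S \ A' ∪ X).ncard)
      linarith
    · have hle' : ((S \ A' ∪ X).ncard : ℝ) ≤ S.ncard := by
        exact_mod_cast (by omega : (S \ A' ∪ X).ncard ≤ S.ncard)
      linarith
  have hmarked := HasMarkedPartition.merge (S := S) ha.le (key A₁ A₂ hA rfl hSA₁ hSA₂)
    (key A₂ A₁ (Set.union_comm A₁ A₂ ▸ hA) (Set.inter_comm _ _) hSA₂ hSA₁)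
    Set.subset_union_right Set.subset_union_right hXk ?_ ?_ ?_
  · rwa [hU] at hmarked
  · intro v hv w hw hvw
    rw [hU] at hv hw
    exact (hAadj v w hvw).imp (fun h => ⟨⟨hv, h.1⟩, hw, h.2⟩) fun h => ⟨⟨hv, h.1⟩, hw, h.2⟩
  · intro v hv
    by_cases h₁ : v ∈ A₁
    · by_cases h₂ : v ∈ A₂
      · exact .inl (.inr ⟨⟨hSU hv, h₁⟩, hSU hv, h₂⟩)
      · exact .inl (.inl ⟨hv, h₂⟩)
    · exact .inr (.inl ⟨hv, h₁⟩)
  · have hdisj : Disjoint (S \ A₂) (S \ A₁) := by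
      refine Set.disjoint_left.2 fun v h₂ h₁ => ?_
      rcases (hA ▸ Set.mem_univ v : v ∈ A₁ ∪ A₂) with h | h
      · exact h₁.2 h
      · exact h₂.2 h
    have hle := Set.ncard_le_ncard (Set.union_subset (Set.sdiff_subset : S \ A₂ ⊆ S)
      (Set.sdiff_subset : S \ A₁ ⊆ S))
    rw [Set.ncard_union_eq hdisj] at hle
    have h₁ := Set.ncard_union_le (S \ A₂) X
    have h₂ := Set.ncard_union_le (S \ A₁) X
    rw [← hX]
    omega

/-- Fix positive integers `k`, `d` and a real `α > 2`. Let `G` be a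
graph with `tw(G) ≤ k − 1` and `Δ(G) ≤ d`. For any set `S ⊆ V(G)` with
`αk ≤ |S| ≤ 3αkd`, there is a tree-partition `(B x : x ∈ V(T))` of `G` with width at most
`(3α(α−1)/(α−2))·kd − (α/(α−2))·k`, such that `Δ(T) ≤ (3α/(α−2))·d + (α−4)/(α−2)` and
there is a node `z ∈ V(T)` with `S ⊆ B z`, `|B z| ≤ ((α−1)/(α−2))·|S| − (α/(α−2))·k` and
`deg_T(z) ≤ (1/((α−2)k))·|S| − 2/(α−2)`. -/
theorem exists_treePartition_alpha_with_marked_set (k d : ℕ) (hk : 1 ≤ k) (hd : 1 ≤ d)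
    (α : ℝ) (hα : 2 < α)
    {V : Type} [Fintype V] (G : SimpleGraph V)
    (htw : treewidth G ≤ k - 1) (hΔ : maxDeg G ≤ d)
    (S : Set V) (hS₁ : α * k ≤ (S.ncard : ℝ)) (hS₂ : (S.ncard : ℝ) ≤ 3 * α * (k * d)) :
    ∃ (ι : Type) (_ : Fintype ι) (T : SimpleGraph ι) (B : ι → Set V),
      IsTreePartition G T B ∧
      (∀ x, ((B x).ncard : ℝ) ≤ 3 * α * (α - 1) / (α - 2) * (k * d) - α / (α - 2) * k) ∧
      (∀ x, ((T.neighborSet x).ncard : ℝ) ≤ 3 * α / (α - 2) * d + (α - 4) / (α - 2)) ∧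
      ∃ z, S ⊆ B z ∧
        ((B z).ncard : ℝ) ≤ (α - 1) / (α - 2) * S.ncard - α / (α - 2) * k ∧
        ((T.neighborSet z).ncard : ℝ) ≤ 1 / ((α - 2) * k) * S.ncard - 2 / (α - 2) := by
  have hsep := hasBalancedSeparations_of_treewidth_lt (lt_of_le_of_lt htw (Nat.sub_lt hk one_pos))
  have hdeg v := (ncard_neighborSet_le_maxDeg G v).trans hΔ
  have hα' : α - 2 ≠ 0 := by linarith
  have hkR : (0 : ℝ) < k := by exact_mod_cast hk
  obtain ⟨a, ha⟩ : ∃ a : ℝ, a = 1 / (α - 2) := ⟨_, rfl⟩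
  have ha₀ : 0 < a := ha ▸ one_div_pos.2 (by linarith)
  have haα : a * α = 1 + 2 * a := by rw [ha]; field_simp; ring
  have h₁ : (α - 1) / (α - 2) = 1 + a := by rw [ha]; field_simp; ring
  have h₂ : α / (α - 2) = 1 + 2 * a := by rw [ha]; field_simp; ring
  have h₃ : (α - 4) / (α - 2) = 1 - 2 * a := by rw [ha]; field_simp; ring
  have h₄ : 2 / (α - 2) = 2 * a := by rw [ha]; ring
  have h₅ : 3 * α * (α - 1) / (α - 2) = 3 * α + 3 + 6 * a := by
    rw [mul_div_assoc, h₁]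
    linarith
  have h₆ : 3 * α / (α - 2) = 3 + 6 * a := by
    rw [mul_div_assoc, h₂]
    ring
  have h₇ : 1 / ((α - 2) * k) * S.ncard = a * S.ncard / k := by rw [ha]; field_simp
  rw [h₁, h₂, h₃, h₄, h₅, h₆, h₇]
  obtain ⟨ι, _, p, B, H, hBW, hpD, hroot, hBroot, hproot⟩ :=
    hasMarkedPartition_of_hasBalancedSeparations hk hd hsep hdeg ha₀ haα rfl rfl
      Set.univ S (Set.subset_univ S) hS₁ hS₂
  have hSa := mul_le_mul_of_nonneg_left hS₂ ha₀.le
  have haαkd : (a * α) * (k * d) = (1 + 2 * a) * (k * d) := by rw [haα]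
  have hnone : (((parentGraph p).neighborSet none).ncard : ℝ) ≤ a * S.ncard / k - 2 * a := by
    refine le_trans (Nat.cast_le.2 (ncard_neighborSet_parentGraph_none_le p)) ?_
    rw [le_sub_iff_add_le, le_div_iff₀ hkR]
    linarith
  refine ⟨Option ι, Fintype.ofFinite _, parentGraph p, B, H.isTreePartition, ?_, ?_, none, hroot,
    hBroot, hnone⟩
  · rintro (_ | i)
    · have := mul_le_mul_of_nonneg_left hS₂ (show 0 ≤ 1 + a by linarith)
      linarith
    · exact hBW i
  · rintro (_ | i)
    · have : a * S.ncard / k ≤ (3 + 6 * a) * d := by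
        rw [div_le_iff₀ hkR]
        linarith
      linarith
    · refine le_trans ?_ ((hpD i).trans_eq (by ring))
      exact_mod_cast ncard_neighborSet_parentGraph_some_le p i
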